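/- arXiv:1701.03677 — 2 statements merged into one kernel-verified Lean document; each statement's English description precedes it below -/
import Mathlib

section
/- Let m_11, m_12, m_21 be integers with m_11 > m_21 ≥ 0 and m_12 ≥ m_21, set B = m_12 − m_11, let Z = m_11 P_11 + m_12 P_12 + m_21 P_21, and let D = D_1 ∪ D_2 ∪ D_3 ∪ D_4. Define β : ℕ² → ℤ by β(a,b) = 1 on D_1, β(a,b) = φ_{m_21+B, B}(b) on D_2, β(a,b) = 1 + φ_{m_21+B, B}(b) on D_3, β(a,b) = 1 on D_4. Then for every (a,b) ∈ ℕ²: if (a,b) ∈ D then ΔH_Z(a,b) = 1 − β(a,b); if (a,b) ∉ D but there exists (i,j) ∈ D with a ≤ i and b ≤ j, then ΔH_Z(a,b) = 1; otherwise ΔH_Z(a,b) = 0. -/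
open MvPolynomial Module

noncomputable section

/-- The recursively defined function `φ_t(n)` (natural index). -/
def phiNat : ℕ → ℤ → ℤ
  | 0, _ => 0
  | 1, n => if n = 0 then 1 else 0
  | (t+2), n =>
    if 0 ≤ n ∧ n < (t : ℤ) + 1 then phiNat (t+1) n
    else if (t : ℤ) + 1 ≤ n ∧ n < 2 * ((t : ℤ) + 1) + 1 then phiNat (t+1) n + 1
    else 0

/-- `φ_t : ℤ → ℤ`, identically `0` for `t ≤ 0`. -/
def phi (t n : ℤ) : ℤ := if 0 < t then phiNat t.toNat n else 0

/-- `φ_{t,d}(n) = φ_t(n+d) − φ_d(n+d)`. -/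
def phi2 (t d n : ℤ) : ℤ := phi t (n + d) - phi d (n + d)

/-- `(n)_+ = max{n, 0}`. -/
def pos (n : ℤ) : ℤ := max n 0

variable (k : Type*) [Field k] [CharZero k]

/-- The bigrading weights on `k[x₀,x₁,x₂,x₃]`. -/
def w : Fin 4 → ℕ × ℕ := ![(1,0), (1,0), (0,1), (0,1)]

/-- The bihomogeneous component `R_{(a,b)}` as a `k`-subspace. -/
def comp (a b : ℕ) : Submodule k (MvPolynomial (Fin 4) k) :=
  weightedHomogeneousSubmodule k w (a, b)

/-- The irrelevant ideal `𝔪 = (x₀,x₁,x₂,x₃)`. -/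
def mIdeal : Ideal (MvPolynomial (Fin 4) k) :=
  Ideal.span {X 0, X 1, X 2, X 3}

/-- `β_{0,(a,b)}(I) = dim_k (I ∩ R_{(a,b)}) − dim_k ((𝔪·I) ∩ R_{(a,b)})`. -/
def beta0 (I : Ideal (MvPolynomial (Fin 4) k)) (a b : ℕ) : ℤ :=
  (finrank k ↥(I.restrictScalars k ⊓ comp k a b) : ℤ)
    - (finrank k ↥((mIdeal k * I).restrictScalars k ⊓ comp k a b) : ℤ)

/-- The Hilbert function `H(a,b) = (a+1)(b+1) − dim_k (I ∩ R_{(a,b)})`, `0` off `ℕ²`. -/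
def HF (I : Ideal (MvPolynomial (Fin 4) k)) (a b : ℤ) : ℤ :=
  if 0 ≤ a ∧ 0 ≤ b then
    (a + 1) * (b + 1) - (finrank k ↥(I.restrictScalars k ⊓ comp k a.toNat b.toNat) : ℤ)
  else 0

/-- The first difference `ΔH(a,b)`. -/
def dHF (I : Ideal (MvPolynomial (Fin 4) k)) (a b : ℤ) : ℤ :=
  HF k I a b + HF k I (a-1) (b-1) - HF k I (a-1) b - HF k I a (b-1)

def I11 : Ideal (MvPolynomial (Fin 4) k) := Ideal.span {X 0, X 2}
def I12 : Ideal (MvPolynomial (Fin 4) k) := Ideal.span {X 0, X 3}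
def I21 : Ideal (MvPolynomial (Fin 4) k) := Ideal.span {X 1, X 2}

/-- The ideal of `Z = m₁₁P₁₁ + m₁₂P₁₂ + m₂₁P₂₁`. -/
def IZ (m11 m12 m21 : ℕ) : Ideal (MvPolynomial (Fin 4) k) :=
  I11 k ^ m11 ⊓ I12 k ^ m12 ⊓ I21 k ^ m21

/-- `max{m₁₁, m₁₂ + m₂₁}`. -/
def Dbound (m11 m12 m21 : ℕ) : ℤ := max (m11 : ℤ) ((m12 : ℤ) + m21)

def D1set (m11 m12 m21 : ℕ) : Set (ℕ × ℕ) :=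
  {p | (p.2 : ℤ) < pos (-((m12 : ℤ) - m11)) - pos (-((m12 : ℤ) - m11) - m21) ∧
       (p.1 : ℤ) + 2 * p.2 = (m11 : ℤ) + m21}

def D2set (m11 m12 m21 : ℕ) : Set (ℕ × ℕ) :=
  {p | pos (-((m12 : ℤ) - m11)) - pos (-((m12 : ℤ) - m11) - m21) ≤ (p.2 : ℤ) ∧
       (p.2 : ℤ) < m21 ∧ (p.1 : ℤ) + p.2 = Dbound m11 m12 m21}

def D3set (m11 m12 m21 : ℕ) : Set (ℕ × ℕ) :=
  {p | (m21 : ℤ) ≤ p.2 ∧ (p.2 : ℤ) ≤ m21 + |((m12 : ℤ) - m11) + m21| ∧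
       (p.1 : ℤ) + p.2 = Dbound m11 m12 m21}

def D4set (m11 m12 m21 : ℕ) : Set (ℕ × ℕ) :=
  {p | (m21 : ℤ) + |((m12 : ℤ) - m11) + m21| < (p.2 : ℤ) ∧
       2 * (p.1 : ℤ) + p.2 = (m11 : ℤ) + m12}


namespace MvPolynomial

/-- The `m`-th power of the ideal generated by two variables consists of the polynomials all of
whose monomials have degree at least `m` in these variables. -/
lemma mem_span_pair_X_pow {σ R : Type*} [CommSemiring R] {i j : σ} (hij : i ≠ j) (m : ℕ)
    (f : MvPolynomial σ R) :
    f ∈ (Ideal.span {X i, X j} : Ideal (MvPolynomial σ R)) ^ m ↔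
      ∀ d ∈ f.support, m ≤ d i + d j := by
  classical
  constructor
  · intro hf
    have hupper (n : ℕ) : IsUpperSet {d : σ →₀ ℕ | n ≤ d i + d j} := by
      intro d e hde hd
      have hi := hde i
      have hj := hde j
      simp only [Set.mem_ofPred_eq] at hd ⊢
      omega
    have hpow : (Ideal.span {X i, X j} : Ideal (MvPolynomial σ R)) ^ m ≤
        restrictSupportIdeal R _ (hupper m) := by
      clear hf
      induction m with
      | zero =>
        intro f _ d _
        exact Nat.zero_le _
      | succ m ih =>
        rw [pow_succ, Ideal.mul_le]
        intro p hp q hq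
        replace hp := ih hp
        obtain ⟨u, v, rfl⟩ := Ideal.mem_span_pair.1 hq
        rw [mul_add, mul_left_comm, mul_left_comm p v]
        refine Ideal.add_mem _ (Ideal.mul_mem_left _ _ ?_) (Ideal.mul_mem_left _ _ ?_)
        all_goals
          refine (mem_restrictSupport_iff R).2 fun d hd => ?_
          rw [Finset.mem_coe, support_mul_X, Finset.mem_map] at hd
          obtain ⟨e, he, rfl⟩ := hd
          have : m ≤ e i + e j := hp he
          simp [hij, hij.symm]
          omega
    exact fun d hd => hpow hf hd
  · intro hf
    rw [f.as_sum]
    refine Ideal.sum_mem _ fun d hd => ?_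
    have hd' : Finsupp.single i (d i) + Finsupp.single j (d j) ≤ d := by
      intro l
      by_cases hi : i = l
      · subst hi
        simp [hij.symm]
      · by_cases hj : j = l
        · subst hj
          simp [hij]
        · simp [hi, hj]
    have hmon : monomial d (coeff d f) =
        monomial (d - (Finsupp.single i (d i) + Finsupp.single j (d j))) (coeff d f) *
          (X i ^ d i * X j ^ d j) := by
      rw [X_pow_eq_monomial, X_pow_eq_monomial, monomial_mul, monomial_mul, mul_one, mul_one,
        tsub_add_cancel_of_le hd']
    rw [hmon]
    refine Ideal.mul_mem_left _ _ (Ideal.pow_le_pow_right (hf d hd) ?_)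
    rw [pow_add]
    exact Ideal.mul_mem_mul (Ideal.pow_mem_pow (Ideal.subset_span (by simp)) _)
      (Ideal.pow_mem_pow (Ideal.subset_span (by simp)) _)

end MvPolynomial

/-- The monomials of bidegree `(a, b)` in the ideal of `Z`, recorded by their exponents of
`x₀` and `x₂`. -/
lemma finrank_IZ_inf_comp (K : Type*) [Field K] (m11 m12 m21 a b N : ℕ) (ha : a < N) (hb : b < N) :
    finrank K ↥((IZ K m11 m12 m21).restrictScalars K ⊓ comp K a b) =
      (Finset.card {p ∈ Finset.range N ×ˢ Finset.range N |
        m11 ≤ p.1 + p.2 ∧ p.1 + (m21 - p.2) ≤ a ∧ p.2 + (m12 - p.1) ≤ b}) := by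
  set s : Set (Fin 4 →₀ ℕ) := {d | (m11 ≤ d 0 + d 2 ∧ m12 ≤ d 0 + d 3 ∧ m21 ≤ d 1 + d 2) ∧
    d 0 + d 1 = a ∧ d 2 + d 3 = b} with hs
  have hweight (d : Fin 4 →₀ ℕ) :
      Finsupp.weight w d = (a, b) ↔ d 0 + d 1 = a ∧ d 2 + d 3 = b := by
    rw [Finsupp.weight_eq_sum]
    simp [Fin.sum_univ_four, w, Prod.ext_iff, -nsmul_eq_mul]
  have hsupp : (IZ K m11 m12 m21).restrictScalars K ⊓ comp K a b = restrictSupport K s := by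
    ext f
    rw [mem_restrictSupport_iff, Submodule.mem_inf, Submodule.restrictScalars_mem, comp,
      mem_weightedHomogeneousSubmodule, IZ, Ideal.mem_inf, Ideal.mem_inf, I11, I12, I21,
      mem_span_pair_X_pow (by decide), mem_span_pair_X_pow (by decide),
      mem_span_pair_X_pow (by decide)]
    constructor
    · rintro ⟨⟨⟨h1, h2⟩, h3⟩, h4⟩ d hd
      exact ⟨⟨h1 d hd, h2 d hd, h3 d hd⟩, (hweight d).1 (h4 (mem_support_iff.1 hd))⟩
    · intro h
      exact ⟨⟨⟨fun d hd => (h hd).1.1, fun d hd => (h hd).1.2.1⟩, fun d hd => (h hd).1.2.2⟩,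
        fun d hd => (hweight d).2 (h (mem_support_iff.2 hd)).2⟩
  rw [hsupp, finrank_eq_nat_card_basis (basisRestrictSupport K s), Nat.card_coe_set_eq,
    ← Set.ncard_coe_finset]
  refine Set.ncard_congr (fun d _ => (d 0, d 2)) ?_ ?_ ?_
  · intro d hd
    simp only [hs, Set.mem_ofPred_eq] at hd
    simp only [Finset.coe_filter, Finset.mem_product, Finset.mem_range, Set.mem_ofPred_eq]
    omega
  · intro d e hd he hde
    simp only [hs, Set.mem_ofPred_eq] at hd he
    simp only [Prod.mk.injEq] at hde
    ext l
    fin_cases l <;> simp <;> omega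
  · rintro ⟨i, j⟩ hp
    simp only [Finset.coe_filter, Finset.mem_product, Finset.mem_range, Set.mem_ofPred_eq] at hp
    refine ⟨Finsupp.equivFunOnFinite.symm ![i, a - i, j, b - j], ?_, by simp⟩
    simp [hs]
    omega

lemma HF_IZ (K : Type*) [Field K] (m11 m12 m21 N : ℕ) (a b : ℤ) (ha : -1 ≤ a) (hb : -1 ≤ b)
    (haN : a < N) (hbN : b < N) :
    HF K (IZ K m11 m12 m21) a b = (a + 1) * (b + 1) -
      ∑ p ∈ Finset.range N ×ˢ Finset.range N,
        if m11 ≤ p.1 + p.2 ∧ ((p.1 + (m21 - p.2) : ℕ) : ℤ) ≤ a ∧ ((p.2 + (m12 - p.1) : ℕ) : ℤ) ≤ b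
        then 1 else 0 := by
  by_cases h : 0 ≤ a ∧ 0 ≤ b
  · rw [HF, if_pos h]
    obtain ⟨a, rfl⟩ := Int.eq_ofNat_of_zero_le h.1
    obtain ⟨b, rfl⟩ := Int.eq_ofNat_of_zero_le h.2
    rw [finrank_IZ_inf_comp K m11 m12 m21 _ _ N (by omega) (by omega), Finset.sum_boole]
    simp only [Nat.cast_le, Int.toNat_natCast]
  · rw [HF, if_neg h, Finset.sum_eq_zero]
    · have : a + 1 = 0 ∨ b + 1 = 0 := by omega
      rcases this with h | h <;> simp [h]
    · intro p _
      rw [if_neg]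
      omega

/-- The points `(i, j)` with `i + j ≥ m₁₁` index a basis of `I_Z` over `K[x₁, x₃]`; those of
bidegree `(a, b)` are counted by `1 - ΔH_Z(a, b)`. -/
lemma dHF_IZ (K : Type*) [Field K] (m11 m12 m21 a b : ℕ) :
    dHF K (IZ K m11 m12 m21) a b = 1 -
      ∑ p ∈ Finset.range (a + b + 1) ×ˢ Finset.range (a + b + 1),
        if m11 ≤ p.1 + p.2 ∧ p.1 + (m21 - p.2) = a ∧ p.2 + (m12 - p.1) = b
        then 1 else 0 := by
  have key : ∀ p : ℕ × ℕ,
      ((if m11 ≤ p.1 + p.2 ∧ p.1 + (m21 - p.2) = a ∧ p.2 + (m12 - p.1) = b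
        then 1 else 0 : ℤ)) =
      (if m11 ≤ p.1 + p.2 ∧ ((p.1 + (m21 - p.2) : ℕ) : ℤ) ≤ a ∧
        ((p.2 + (m12 - p.1) : ℕ) : ℤ) ≤ b then 1 else 0) +
      (if m11 ≤ p.1 + p.2 ∧ ((p.1 + (m21 - p.2) : ℕ) : ℤ) ≤ (a : ℤ) - 1 ∧
        ((p.2 + (m12 - p.1) : ℕ) : ℤ) ≤ (b : ℤ) - 1 then 1 else 0) -
      (if m11 ≤ p.1 + p.2 ∧ ((p.1 + (m21 - p.2) : ℕ) : ℤ) ≤ (a : ℤ) - 1 ∧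
        ((p.2 + (m12 - p.1) : ℕ) : ℤ) ≤ b then 1 else 0) -
      (if m11 ≤ p.1 + p.2 ∧ ((p.1 + (m21 - p.2) : ℕ) : ℤ) ≤ a ∧
        ((p.2 + (m12 - p.1) : ℕ) : ℤ) ≤ (b : ℤ) - 1 then 1 else 0) := by
    intro p
    generalize p.1 + (m21 - p.2) = u
    generalize p.2 + (m12 - p.1) = v
    by_cases hm : m11 ≤ p.1 + p.2
    · simp only [hm, true_and]
      split_ifs <;> omega
    · simp [hm]
  rw [Finset.sum_congr rfl fun p _ => key p, Finset.sum_sub_distrib, Finset.sum_sub_distrib,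
    Finset.sum_add_distrib, dHF]
  rw [HF_IZ K m11 m12 m21 (a + b + 1) a b, HF_IZ K m11 m12 m21 (a + b + 1) (a - 1) (b - 1),
    HF_IZ K m11 m12 m21 (a + b + 1) (a - 1) b, HF_IZ K m11 m12 m21 (a + b + 1) a (b - 1)]
  · ring
  all_goals push_cast; omega

lemma sum_generators (m11 m12 m21 a b : ℕ) :
    (∑ p ∈ Finset.range (a + b + 1) ×ˢ Finset.range (a + b + 1),
        if m11 ≤ p.1 + p.2 ∧ p.1 + (m21 - p.2) = a ∧ p.2 + (m12 - p.1) = b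
        then 1 else 0 : ℤ) =
      (if m12 ≤ a ∧ m21 ≤ b ∧ m11 ≤ a + b then 1 else 0) +
      (if a < m12 ∧ m12 + m21 ≤ a + b ∧ m11 + m12 ≤ 2 * a + b then 1 else 0) +
      (if b < m21 ∧ m12 + m21 ≤ a + b ∧ m11 + m21 ≤ a + 2 * b then 1 else 0) +
      (if a + b = m12 + m21 then
        ((min m21 b - max (m21 - a) ((m11 + m21 - a + 1) / 2) : ℕ) : ℤ) else 0) := by
  have hsingle (q : ℕ × ℕ) (P : Prop) [Decidable P]
      (hq : P → q ∈ Finset.range (a + b + 1) ×ˢ Finset.range (a + b + 1)) :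
      (if P then 1 else 0 : ℤ) = ∑ p ∈ Finset.range (a + b + 1) ×ˢ Finset.range (a + b + 1),
        if p = q ∧ P then 1 else 0 := by
    by_cases hP : P
    · simp only [hP, and_true, if_true, Finset.sum_ite_eq', if_pos (hq hP)]
    · simp [hP]
  have hmany : (if a + b = m12 + m21 then
        ((min m21 b - max (m21 - a) ((m11 + m21 - a + 1) / 2) : ℕ) : ℤ) else 0) =
      ∑ p ∈ Finset.range (a + b + 1) ×ˢ Finset.range (a + b + 1),
        if p.1 < m12 ∧ p.2 < m21 ∧ m11 ≤ p.1 + p.2 ∧ p.1 + (m21 - p.2) = a ∧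
          p.2 + (m12 - p.1) = b then 1 else 0 := by
    split_ifs with h
    · rw [Finset.sum_boole, ← Nat.card_Ico]
      congr 1
      refine Finset.card_nbij' (fun j => (a + j - m21, j)) (fun p => p.2) ?_ ?_ ?_ ?_
      · intro j hj
        simp only [Finset.coe_Ico, Set.mem_Ico] at hj
        simp only [Finset.coe_filter, Finset.mem_product, Finset.mem_range, Set.mem_ofPred_eq]
        omega
      · intro p hp
        simp only [Finset.coe_filter, Finset.mem_product, Finset.mem_range,
          Set.mem_ofPred_eq] at hp
        simp only [Finset.coe_Ico, Set.mem_Ico]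
        omega
      · intro j _
        rfl
      · rintro ⟨i, j⟩ hp
        simp only [Finset.coe_filter, Finset.mem_product, Finset.mem_range,
          Set.mem_ofPred_eq] at hp
        simp only [Prod.mk.injEq, and_true]
        omega
    · rw [Finset.sum_eq_zero]
      intro p _
      rw [if_neg]
      omega
  rw [hmany, hsingle (a, b), hsingle (a, a + b - m12), hsingle (a + b - m21, b),
    ← Finset.sum_add_distrib, ← Finset.sum_add_distrib, ← Finset.sum_add_distrib]
  · refine Finset.sum_congr rfl ?_
    rintro ⟨i, j⟩ _
    simp only [Prod.mk.injEq]
    by_cases hi : i < m12 <;> by_cases hj : j < m21 <;> split_ifs <;> omega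
  all_goals
    simp only [Finset.mem_product, Finset.mem_range]
    omega

lemma phiNat_eq (t : ℕ) (n : ℤ) : phiNat t n = max 0 (min (n / 2 + 1) (t - (n + 1) / 2)) := by
  induction t using Nat.twoStepInduction with
  | zero => simp only [phiNat]; omega
  | one => simp only [phiNat]; split_ifs <;> omega
  | more t _ ih =>
    simp only [phiNat, ih]
    split_ifs <;> push_cast <;> omega

lemma phi_eq (t n : ℤ) : phi t n = max 0 (min (n / 2 + 1) (t - (n + 1) / 2)) := by
  rw [phi]
  split_ifs with h
  · rw [phiNat_eq, Int.toNat_of_nonneg h.le]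
  · omega

/-- The values of the bounds that cut out `D₁`, `D₂`, `D₃`, `D₄`, according to the relative position
of the multiplicities. -/
lemma exists_region_bounds (m11 m12 m21 : ℕ) :
    ∃ c e s : ℕ, pos (-((m12 : ℤ) - m11)) - pos (-((m12 : ℤ) - m11) - m21) = c ∧
      (m21 : ℤ) + |((m12 : ℤ) - m11) + m21| = e ∧ Dbound m11 m12 m21 = s ∧
      ((m11 ≤ m12 ∧ c = 0 ∧ s = m12 + m21 ∧ e + m11 = 2 * m21 + m12) ∨
        (m12 < m11 ∧ m11 ≤ m12 + m21 ∧ c + m12 = m11 ∧ s = m12 + m21 ∧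
          e + m11 = 2 * m21 + m12) ∨
        (m12 + m21 < m11 ∧ c = m21 ∧ s = m11 ∧ e + m12 = m11)) := by
  simp only [pos, Dbound, abs_eq_max_neg]
  rcases le_or_gt m11 m12 with h | h
  · exact ⟨0, 2 * m21 + m12 - m11, m12 + m21, by omega, by omega, by omega, by omega⟩
  · rcases le_or_gt m11 (m12 + m21) with h' | h'
    · exact ⟨m11 - m12, 2 * m21 + m12 - m11, m12 + m21, by omega, by omega, by omega, by omega⟩
    · exact ⟨m21, m11 - m12, m11, by omega, by omega, by omega, by omega⟩

set_option maxHeartbeats 1000000 in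
/-- Proposition 5.4: first difference of the Hilbert function of
`Z = m₁₁P₁₁ + m₁₂P₁₂ + m₂₁P₂₁` when `m₁₁ > m₂₁ ≥ 0` and `m₁₂ ≥ m₂₁`,
described via the regions `D₁, D₂, D₃, D₄` (with `B = m₁₂ − m₁₁`). -/
theorem deltaHF_three_fat_points_case2 (m11 m12 m21 : ℕ)
    (h1 : m21 < m11) (h2 : m21 ≤ m12) (a b : ℕ) :
    ((a, b) ∈ D1set m11 m12 m21 → dHF k (IZ k m11 m12 m21) a b = 1 - 1) ∧
    ((a, b) ∈ D2set m11 m12 m21 → dHF k (IZ k m11 m12 m21) a b =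
        1 - phi2 ((m21 : ℤ) + ((m12 : ℤ) - m11)) ((m12 : ℤ) - m11) b) ∧
    ((a, b) ∈ D3set m11 m12 m21 → dHF k (IZ k m11 m12 m21) a b =
        1 - (1 + phi2 ((m21 : ℤ) + ((m12 : ℤ) - m11)) ((m12 : ℤ) - m11) b)) ∧
    ((a, b) ∈ D4set m11 m12 m21 → dHF k (IZ k m11 m12 m21) a b = 1 - 1) ∧
    ((a, b) ∉ D1set m11 m12 m21 ∪ D2set m11 m12 m21 ∪ D3set m11 m12 m21 ∪ D4set m11 m12 m21 →
      (∃ q ∈ D1set m11 m12 m21 ∪ D2set m11 m12 m21 ∪ D3set m11 m12 m21 ∪ D4set m11 m12 m21,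
        a ≤ q.1 ∧ b ≤ q.2) →
      dHF k (IZ k m11 m12 m21) a b = 1) ∧
    ((a, b) ∉ D1set m11 m12 m21 ∪ D2set m11 m12 m21 ∪ D3set m11 m12 m21 ∪ D4set m11 m12 m21 →
      ¬(∃ q ∈ D1set m11 m12 m21 ∪ D2set m11 m12 m21 ∪ D3set m11 m12 m21 ∪ D4set m11 m12 m21,
        a ≤ q.1 ∧ b ≤ q.2) →
      dHF k (IZ k m11 m12 m21) a b = 0) := by
  obtain ⟨c, e, s, hc, he, hs, hreg⟩ := exists_region_bounds m11 m12 m21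
  rw [dHF_IZ, sum_generators]
  simp only [phi2, phi_eq, D1set, D2set, D3set, D4set, hc, he, hs, Set.mem_union,
    Set.mem_ofPred_eq]
  clear hc he hs
  refine ⟨?_, ?_, ?_, ?_, ?_, ?_⟩
  · rintro ⟨hb, hab⟩
    rcases hreg with hreg | hreg | hreg <;> split_ifs <;> omega
  · rintro ⟨hcb, hb, hab⟩
    rcases hreg with hreg | hreg | hreg <;> split_ifs <;> omega
  · rintro ⟨hcb, hb, hab⟩
    rcases hreg with hreg | hreg | hreg <;> split_ifs <;> omega
  · rintro ⟨hb, hab⟩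
    rcases hreg with hreg | hreg | hreg <;> split_ifs <;> omega
  · rintro hD ⟨q, hq, haq, hbq⟩
    have hbelow : (b < c → a + 2 * b < m11 + m21) ∧ (c ≤ b → b ≤ e → a + b < s) ∧
        (e < b → 2 * a + b < m11 + m12) := by
      rcases hreg with hreg | hreg | hreg <;> rcases hq with ((hq | hq) | hq) | hq <;>
        refine ⟨?_, ?_, ?_⟩ <;> omega
    clear hD hq haq hbq
    rw [if_neg (by omega), if_neg (by omega), if_neg (by omega)]
    rcases hreg with hreg | hreg | hreg <;> split_ifs <;> omega
  · intro hD hmax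
    have habove : (b < c → m11 + m21 < a + 2 * b) ∧ (c ≤ b → b ≤ e → s < a + b) ∧
        (e < b → m11 + m12 < 2 * a + b) := by
      refine ⟨fun hb => ?_, fun hcb hb => ?_, fun hb => ?_⟩ <;> by_contra hle <;> apply hmax
      · refine ⟨(m11 + m21 - 2 * b, b), ?_⟩
        dsimp only
        omega
      · refine ⟨(s - b, b), ?_⟩
        dsimp only
        omega
      · refine ⟨(a, m11 + m12 - 2 * a), ?_⟩
        dsimp only
        omega
    clear hD hmax
    rcases lt_or_ge a m12 with ha | ha <;> rcases lt_or_ge b m21 with hb | hb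
    · omega
    · rw [if_neg (by omega), if_pos (by omega), if_neg (by omega)]
      split_ifs <;> omega
    · rw [if_neg (by omega), if_neg (by omega), if_pos (by omega)]
      split_ifs <;> omega
    · rw [if_pos (by omega), if_neg (by omega), if_neg (by omega)]
      split_ifs <;> omega

end
end

section
/- Let m ≥ 0 be an integer and let Z = m P_11 + m P_12 + m P_21 be the homogeneous set of fat points. Then for all integers a, b ≥ 0: ΔH_Z(a,b) = 1 if a + b < 2m; ΔH_Z(a,b) = 1 − φ_{m+1}(b) if a + b = 2m; and ΔH_Z(a,b) = 0 if a + b > 2m. -/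
open MvPolynomial Module

noncomputable section

variable (k : Type*) [Field k] [CharZero k]

lemma phiNat_succ (t : ℕ) {n : ℤ} (hn : 0 ≤ n) :
    phiNat (t + 1) n = if n ≤ 2 * t then min (t : ℤ) n - (n + 1) / 2 + 1 else 0 := by
  induction t with
  | zero =>
    simp only [phiNat]
    split_ifs <;> omega
  | succ t ih =>
    simp only [phiNat, ih]
    push_cast
    split_ifs <;> omega

section MonomialIdeals

variable {K σ : Type*} [CommRing K]

/-- A power of the ideal generated by two variables consists of the polynomials all of whose
monomials have sufficiently high total degree in these variables. -/
lemma mem_span_pair_X_pow_iff {i j : σ} (hij : i ≠ j) (m : ℕ) (p : MvPolynomial σ K) :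
    p ∈ (Ideal.span {X i, X j} : Ideal (MvPolynomial σ K)) ^ m ↔
      ∀ s ∈ p.support, m ≤ s i + s j := by
  classical
  constructor
  · intro hp
    induction m generalizing p with
    | zero => simp
    | succ m ih =>
      rw [pow_succ] at hp
      induction hp using Submodule.mul_induction_on' with
      | mem_mul_mem f hf g hg =>
        intro s hs
        obtain ⟨u, hu, v, hv, rfl⟩ := Finset.mem_add.1 (support_mul f g hs)
        have hu' := ih f hf u hu
        have hv' : 1 ≤ v i + v j := by
          rw [← Set.image_pair, mem_ideal_span_X_image] at hg
          obtain ⟨l, hl, hl'⟩ := hg v hv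
          rcases hl with rfl | rfl <;> omega
        simp only [Finsupp.add_apply]
        omega
      | add f _ g _ hf hg =>
        intro s hs
        rcases Finset.mem_union.1 (support_add hs) with h | h
        · exact hf s h
        · exact hg s h
  · intro hp
    rw [p.as_sum]
    refine Ideal.sum_mem _ fun s hs => ?_
    have hdecomp : s = Finsupp.single i (s i) + Finsupp.single j (s j) +
        (s.erase i).erase j := by
      ext l
      by_cases hi : l = i
      · subst hi; simp [hij]
      · by_cases hj : l = j
        · subst hj; simp [hij.symm]
        · simp [hi, hj]
    have hfactor : monomial s (coeff s p) =
        X i ^ s i * X j ^ s j * monomial ((s.erase i).erase j) (coeff s p) := by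
      rw [X_pow_eq_monomial, X_pow_eq_monomial, monomial_mul, monomial_mul, ← hdecomp]
      simp
    rw [hfactor]
    refine Ideal.mul_mem_right _ _ (Ideal.pow_le_pow_right (hp s hs) ?_)
    rw [pow_add]
    exact Ideal.mul_mem_mul (Ideal.pow_mem_pow (Ideal.subset_span (by simp)) _)
      (Ideal.pow_mem_pow (Ideal.subset_span (by simp)) _)

end MonomialIdeals

lemma weight_w_eq_iff (s : Fin 4 →₀ ℕ) (a b : ℕ) :
    Finsupp.weight w s = (a, b) ↔ s 0 + s 1 = a ∧ s 2 + s 3 = b := by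
  rw [Finsupp.weight_apply, Finsupp.sum_fintype _ _ (by simp)]
  simp [Fin.sum_univ_four, w, Prod.ext_iff]

/-- The pairs `(i, j)` for which the monomial `x₀ ^ i x₁ ^ (a - i) x₂ ^ j x₃ ^ (b - j)` lies in
the ideal of `mP₁₁ + mP₁₂ + mP₂₁`. -/
def exponentPairs (m : ℕ) (a b : ℤ) : Finset (ℤ × ℤ) :=
  (Finset.Icc 0 a ×ˢ Finset.Icc 0 b).filter fun p =>
    (m : ℤ) ≤ p.1 + p.2 ∧ (m : ℤ) ≤ p.1 + (b - p.2) ∧ (m : ℤ) ≤ (a - p.1) + p.2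

lemma mem_exponentPairs {m : ℕ} {a b : ℤ} {p : ℤ × ℤ} :
    p ∈ exponentPairs m a b ↔ (0 ≤ p.1 ∧ p.1 ≤ a) ∧ (0 ≤ p.2 ∧ p.2 ≤ b) ∧
      (m : ℤ) ≤ p.1 + p.2 ∧ (m : ℤ) ≤ p.1 + (b - p.2) ∧ (m : ℤ) ≤ (a - p.1) + p.2 := by
  simp [exponentPairs, and_assoc]

/-- The exponents of the monomials of bidegree `(a, b)` in the ideal of `mP₁₁ + mP₁₂ + mP₂₁`. -/
def exponentSet (m a b : ℕ) : Set (Fin 4 →₀ ℕ) :=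
  {s | m ≤ s 0 + s 2 ∧ m ≤ s 0 + s 3 ∧ m ≤ s 1 + s 2 ∧ s 0 + s 1 = a ∧ s 2 + s 3 = b}

lemma card_exponentSet (m a b : ℕ) :
    Nat.card (exponentSet m a b) = (exponentPairs m a b).card := by
  rw [← Nat.card_eq_finsetCard]
  refine Nat.card_eq_of_bijective
    (fun s : exponentSet m a b => (⟨((s.1 0 : ℤ), (s.1 2 : ℤ)), ?_⟩ : exponentPairs m a b))
    ⟨?_, ?_⟩
  · obtain ⟨s, h₁, h₂, h₃, h₄, h₅⟩ := s
    rw [mem_exponentPairs]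
    dsimp only
    omega
  · rintro ⟨s, _, _, _, hs₁, hs₂⟩ ⟨t, _, _, _, ht₁, ht₂⟩ hst
    simp only [Subtype.mk.injEq, Prod.mk.injEq, Nat.cast_inj] at hst
    obtain ⟨h₀, h₂⟩ := hst
    ext l
    fin_cases l <;> simp <;> omega
  · rintro ⟨⟨i, j⟩, hp⟩
    rw [mem_exponentPairs] at hp
    dsimp only at hp
    lift i to ℕ using hp.1.1
    lift j to ℕ using hp.2.1.1
    refine ⟨⟨Finsupp.equivFunOnFinite.symm ![i, a - i, j, b - j], ?_⟩, by simp⟩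
    simp only [exponentSet, Set.mem_ofPred_eq, Finsupp.equivFunOnFinite_symm_apply_apply,
      Matrix.cons_val]
    omega

section HilbertFunction

variable (K : Type*) [Field K]

lemma IZ_inf_comp_eq_restrictSupport (m a b : ℕ) :
    (IZ K m m m).restrictScalars K ⊓ comp K a b = restrictSupport K (exponentSet m a b) := by
  ext p
  simp only [IZ, I11, I12, I21, comp, Submodule.mem_inf, Submodule.restrictScalars_mem,
    mem_span_pair_X_pow_iff (show (0 : Fin 4) ≠ 2 by decide),
    mem_span_pair_X_pow_iff (show (0 : Fin 4) ≠ 3 by decide),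
    mem_span_pair_X_pow_iff (show (1 : Fin 4) ≠ 2 by decide),
    mem_weightedHomogeneousSubmodule, IsWeightedHomogeneous, weight_w_eq_iff,
    mem_restrictSupport_iff, Set.subset_def, exponentSet, Set.mem_ofPred_eq, Finset.mem_coe,
    ← MvPolynomial.mem_support_iff]
  grind

lemma finrank_IZ_inf_comp_s9 (m a b : ℕ) :
    finrank K ↥((IZ K m m m).restrictScalars K ⊓ comp K a b) = (exponentPairs m a b).card := by
  rw [IZ_inf_comp_eq_restrictSupport, finrank_eq_nat_card_basis (basisRestrictSupport K _),
    card_exponentSet]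

lemma HF_IZ_eq (m : ℕ) {a b : ℤ} (ha : -1 ≤ a) (hb : -1 ≤ b) :
    HF K (IZ K m m m) a b = (a + 1) * (b + 1) - (exponentPairs m a b).card := by
  unfold HF
  split_ifs with h
  · rw [finrank_IZ_inf_comp_s9, Int.toNat_of_nonneg h.1, Int.toNat_of_nonneg h.2]
  · have hempty : exponentPairs m a b = ∅ := by
      ext p
      rw [mem_exponentPairs]
      simp only [Finset.notMem_empty, iff_false]
      omega
    have hab : a + 1 = 0 ∨ b + 1 = 0 := by omega
    rw [hempty, mul_eq_zero.2 hab]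
    simp

/-- The exponent pairs in bidegree `(a, b)` which do not come from a smaller bidegree. -/
def newExponentPairs (m : ℕ) (a b : ℤ) : Finset (ℤ × ℤ) :=
  exponentPairs m a b \ (exponentPairs m (a - 1) b ∪ exponentPairs m a (b - 1))

lemma card_newExponentPairs (m : ℕ) (a b : ℤ) :
    ((newExponentPairs m a b).card : ℤ) = (exponentPairs m a b).card +
      (exponentPairs m (a - 1) (b - 1)).card - (exponentPairs m (a - 1) b).card -
      (exponentPairs m a (b - 1)).card := by
  have hinter : exponentPairs m (a - 1) b ∩ exponentPairs m a (b - 1) =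
      exponentPairs m (a - 1) (b - 1) := by
    ext p
    simp only [Finset.mem_inter, mem_exponentPairs]
    omega
  have hsub : exponentPairs m (a - 1) b ∪ exponentPairs m a (b - 1) ⊆ exponentPairs m a b := by
    intro p
    simp only [Finset.mem_union, mem_exponentPairs]
    omega
  have h₁ := Finset.card_sdiff_add_card_eq_card hsub
  have h₂ := Finset.card_union_add_card_inter (exponentPairs m (a - 1) b)
    (exponentPairs m a (b - 1))
  rw [hinter] at h₂
  rw [newExponentPairs]
  omega

lemma mem_newExponentPairs {m : ℕ} {a b : ℤ} {p : ℤ × ℤ} :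
    p ∈ newExponentPairs m a b ↔ p ∈ exponentPairs m a b ∧
      (p.1 = a ∨ a - p.1 + p.2 = m) ∧ (p.2 = b ∨ p.1 + (b - p.2) = m) := by
  simp only [newExponentPairs, Finset.mem_sdiff, Finset.mem_union, mem_exponentPairs]
  omega

lemma dHF_IZ_eq (m a b : ℕ) :
    dHF K (IZ K m m m) a b = 1 - (newExponentPairs m a b).card := by
  rw [dHF, HF_IZ_eq K m (by omega) (by omega), HF_IZ_eq K m (by omega) (by omega),
    HF_IZ_eq K m (by omega) (by omega), HF_IZ_eq K m (by omega) (by omega),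
    card_newExponentPairs]
  ring

end HilbertFunction

lemma card_newExponentPairs_of_lt {m a b : ℕ} (h : a + b < 2 * m) :
    (newExponentPairs m a b).card = 0 := by
  rw [Finset.card_eq_zero]
  ext p
  simp only [mem_newExponentPairs, mem_exponentPairs, Finset.notMem_empty, iff_false]
  omega

lemma card_newExponentPairs_of_eq {m a b : ℕ} (h : a + b = 2 * m) :
    ((newExponentPairs m a b).card : ℤ) = phi ((m : ℤ) + 1) b := by
  have himage : newExponentPairs m a b =
      (Finset.Icc (((b : ℤ) + 1) / 2) (min (m : ℤ) b)).image
        fun j : ℤ => (j + m - b, j) := by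
    ext ⟨i, j⟩
    simp only [mem_newExponentPairs, mem_exponentPairs, Finset.mem_image, Finset.mem_Icc,
      Prod.mk.injEq, exists_eq_right_right]
    omega
  rw [himage, Finset.card_image_of_injective _ fun x y hxy => congrArg Prod.snd hxy,
    Int.card_Icc, phi, if_pos (by omega), show ((m : ℤ) + 1).toNat = m + 1 by omega,
    phiNat_succ m (by omega), if_pos (by omega)]
  omega

lemma card_newExponentPairs_of_gt {m a b : ℕ} (h : 2 * m < a + b) :
    (newExponentPairs m a b).card = 1 := by
  rw [Finset.card_eq_one]
  refine ⟨(if b < m then (a + b - m : ℤ) else a, if a < m then (a + b - m : ℤ) else b), ?_⟩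
  ext ⟨i, j⟩
  simp only [mem_newExponentPairs, mem_exponentPairs, Finset.mem_singleton, Prod.mk.injEq]
  split_ifs <;> omega

/-- First difference of the Hilbert function of the homogeneous set of fat points
`Z = mP₁₁ + mP₁₂ + mP₂₁`. -/
theorem deltaHF_homogeneous_fat_points (m : ℕ) (a b : ℕ) :
    ((a : ℤ) + b < 2 * (m : ℤ) → dHF k (IZ k m m m) a b = 1) ∧
    ((a : ℤ) + b = 2 * (m : ℤ) → dHF k (IZ k m m m) a b = 1 - phi ((m : ℤ) + 1) b) ∧
    ((a : ℤ) + b > 2 * (m : ℤ) → dHF k (IZ k m m m) a b = 0) := by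
  rw [dHF_IZ_eq]
  refine ⟨fun h => ?_, fun h => ?_, fun h => ?_⟩
  · rw [card_newExponentPairs_of_lt (by omega)]
    simp
  · rw [card_newExponentPairs_of_eq (by omega)]
  · rw [card_newExponentPairs_of_gt (by omega)]
    simp

end
end
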